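/- arXiv:2510.00870 — 4 statements merged into one kernel-verified Lean document; each statement's English description precedes it below -/
import Mathlib

section
/- Let m be an odd integer with m ≥ 3 and let u ∈ [0,1]. Then log( ((1-u)/(1+u))^m + 1 ) = ((m+1)/2)·log 2 − m·log(1+u) + Σ_{k=0}^{(m-3)/2} log(1 + φ_k) + Σ_{k=0}^{(m-3)/2} log( u² + (1-φ_k)/(1+φ_k) ), where φ_k = cos((2k+1)π/m). -/
open Real MeasureTheory intervalIntegral Finset

lemma aux_prod (n : ℕ) (x y : ℂ) (ζ : ℂ) (h : IsPrimitiveRoot ζ (2*n+1)) :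
    x ^ (2*n+1) + y ^ (2*n+1) = ∏ i ∈ Finset.range (2*n+1), (x + ζ ^ i * y) := by
  rw [h.pow_add_pow_eq_prod_add_mul x y ⟨n, rfl⟩]
  symm
  refine Finset.prod_bij (fun i _ => ζ ^ i) ?_ ?_ ?_ ?_
  · intro i _
    rw [Polynomial.mem_nthRootsFinset (by omega)]
    rw [← pow_mul, mul_comm, pow_mul, h.pow_eq_one, one_pow]
  · intro i hi j hj hij
    exact h.pow_inj (by simpa using hi) (by simpa using hj) hij
  · intro b hb
    rw [Polynomial.mem_nthRootsFinset (by omega)] at hb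
    obtain ⟨i, hi, e⟩ := h.eq_pow_of_pow_eq_one hb
    exact ⟨i, by simpa using hi, e⟩
  · intros; rfl

lemma aux_real (n : ℕ) (x y : ℝ) :
    x ^ (2*n+1) + y ^ (2*n+1) = (x + y) * ∏ k ∈ Finset.range n,
      (x^2 - 2*x*y*Real.cos ((2 * (k : ℝ) + 1) * π / ((2*n+1 : ℕ):ℝ)) + y^2) := by
  have hm : ((2*n+1 : ℕ):ℂ) ≠ 0 := by exact_mod_cast (by omega : 2*n+1 ≠ 0)
  have h := Complex.isPrimitiveRoot_exp (2*n+1) (by omega)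
  have H := aux_prod n x y _ h
  set ζ := Complex.exp (2 * π * Complex.I / ((2*n+1 : ℕ):ℂ)) with hζ
  apply Complex.ofReal_injective
  push_cast
  rw [H, Finset.prod_range_succ', two_mul, Finset.prod_range_add]
  rw [← Finset.prod_range_reflect (fun i => ((x:ℂ) + ζ ^ (n + i + 1) * y)), ← Finset.prod_mul_distrib]
  rw [pow_zero, one_mul, mul_comm]
  congr 1
  rw [← Finset.prod_range_reflect]
  refine Finset.prod_congr rfl fun k hk => ?_
  have hk' : k < n := by simpa using hk
  obtain ⟨d, rfl⟩ : ∃ d, n = k + 1 + d := ⟨n - (k+1), by omega⟩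
  have e1 : k + 1 + d - 1 - k = d := by omega
  have e2 : k + 1 + d - 1 - d = k := by omega
  simp only [e1, e2]
  have hz : ζ ^ (d+1) * ζ ^ (k+1+d+k+1) = 1 := by
    rw [← pow_add, ← h.pow_eq_one]; congr 1; ring
  have hs : ζ ^ (d+1) + ζ ^ (k+1+d+k+1) = -(2 * Complex.cos ((2 * (k : ℂ) + 1) * π / (2 * (k+1+d : ℂ)+1))) := by
    have hm' : (2 * (k+1+d : ℂ)+1) ≠ 0 := by
      push_cast at hm; exact hm
    rw [Complex.two_cos, hζ, ← Complex.exp_nat_mul, ← Complex.exp_nat_mul, neg_add, add_comm]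
    have a1 : ∀ z, -Complex.exp z = Complex.exp (z + π * Complex.I) := by
      intro z; rw [Complex.exp_add, Complex.exp_pi_mul_I]; ring
    obtain ⟨w, hw⟩ : ∃ w : ℂ, (π : ℂ) = (2 * (k+1+d : ℂ)+1) * w :=
      ⟨π / (2 * (k+1+d : ℂ)+1), by rw [mul_div_cancel₀ _ hm']⟩
    have b1 : (2 * (k : ℂ) + 1) * π / (2 * (k+1+d : ℂ)+1) = (2 * (k : ℂ) + 1) * w := by
      rw [div_eq_iff hm', hw]; ring
    have b2 : 2 * (π:ℂ) * Complex.I / ((2 * (k+1+d) + 1 : ℕ) : ℂ) = 2 * w * Complex.I := by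
      rw [div_eq_iff hm, hw]; push_cast; ring
    have c1 : Complex.exp (((k+1+d+k+1 : ℕ) : ℂ) * (2 * w * Complex.I))
        = -Complex.exp ((2 * (k : ℂ) + 1) * w * Complex.I) := by
      rw [a1, hw]; congr 1; push_cast; ring
    have c2 : Complex.exp (((d+1 : ℕ) : ℂ) * (2 * w * Complex.I))
        = -Complex.exp (-((2 * (k : ℂ) + 1) * w) * Complex.I) := by
      rw [a1, hw]; congr 1; push_cast; ring
    rw [b1, b2, c1, c2]
  push_cast
  linear_combination (x:ℂ)*y*hs + (y:ℂ)^2*hz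

theorem stmt_0 (m : ℕ) (hm : Odd m) (hm3 : 3 ≤ m) (u : ℝ) (hu : u ∈ Set.Icc (0:ℝ) 1) :
    Real.log (((1 - u) / (1 + u)) ^ m + 1) =
      ((m : ℝ) + 1) / 2 * Real.log 2 - (m : ℝ) * Real.log (1 + u)
        + (∑ k ∈ Finset.range ((m - 1) / 2),
            Real.log (1 + Real.cos ((2 * (k : ℝ) + 1) * π / m)))
        + ∑ k ∈ Finset.range ((m - 1) / 2),
            Real.log (u ^ 2 + (1 - Real.cos ((2 * (k : ℝ) + 1) * π / m))
              / (1 + Real.cos ((2 * (k : ℝ) + 1) * π / m))) := by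
  obtain ⟨n, rfl⟩ := hm
  have e : (2*n+1-1)/2 = n := by omega
  rw [e]
  obtain ⟨h0, h1⟩ := hu
  have hp : 0 < 1 + u := by linarith
  have hlt : ∀ k ∈ Finset.range n, 0 < 1 + Real.cos ((2 * (k : ℝ) + 1) * π / ((2*n+1:ℕ):ℝ)) ∧
      0 < 1 - Real.cos ((2 * (k : ℝ) + 1) * π / ((2*n+1:ℕ):ℝ)) := by
    intro k hk
    have hk' : (k:ℝ) + 1 ≤ n := by exact_mod_cast (by simpa using hk : k < n)
    have hM : (0:ℝ) < ((2*n+1:ℕ):ℝ) := by positivity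
    have t0 : 0 < (2 * (k : ℝ) + 1) * π / ((2*n+1:ℕ):ℝ) := by positivity
    have t1 : (2 * (k : ℝ) + 1) * π / ((2*n+1:ℕ):ℝ) < π := by
      rw [div_lt_iff₀ hM, mul_comm]
      apply mul_lt_mul_of_pos_left _ Real.pi_pos
      push_cast; linarith
    have c1 := Real.cos_lt_cos_of_nonneg_of_le_pi le_rfl t1.le t0
    have c2 := Real.cos_lt_cos_of_nonneg_of_le_pi t0.le le_rfl t1
    rw [Real.cos_zero] at c1
    rw [Real.cos_pi] at c2
    constructor <;> linarith
  have key : ((1 - u) / (1 + u)) ^ (2*n+1) + 1 = (2 * ∏ k ∈ Finset.range n,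
      (2 * ((1 + Real.cos ((2 * (k : ℝ) + 1) * π / ((2*n+1:ℕ):ℝ))) * (u ^ 2 + (1 - Real.cos ((2 * (k : ℝ) + 1) * π / ((2*n+1:ℕ):ℝ)))
              / (1 + Real.cos ((2 * (k : ℝ) + 1) * π / ((2*n+1:ℕ):ℝ))))))) / (1+u)^(2*n+1) := by
    rw [div_pow, eq_div_iff (by positivity), add_mul, div_mul_cancel₀ _ (by positivity), one_mul,
      aux_real]
    congr 1
    · ring
    · refine Finset.prod_congr rfl fun k hk => ?_
      have := (hlt k hk).1.ne'
      rw [mul_add (1 + Real.cos _), mul_div_cancel₀ _ this]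
      ring
  have hq : ∀ k ∈ Finset.range n, 0 < u ^ 2 + (1 - Real.cos ((2 * (k : ℝ) + 1) * π / ((2*n+1:ℕ):ℝ)))
              / (1 + Real.cos ((2 * (k : ℝ) + 1) * π / ((2*n+1:ℕ):ℝ))) := fun k hk => by
    have := div_pos (hlt k hk).2 (hlt k hk).1
    positivity
  have hf : ∀ k ∈ Finset.range n, 2 * ((1 + Real.cos ((2 * (k : ℝ) + 1) * π / ((2*n+1:ℕ):ℝ))) * (u ^ 2 + (1 - Real.cos ((2 * (k : ℝ) + 1) * π / ((2*n+1:ℕ):ℝ)))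
              / (1 + Real.cos ((2 * (k : ℝ) + 1) * π / ((2*n+1:ℕ):ℝ))))) ≠ 0 := fun k hk =>
    (mul_pos two_pos (mul_pos (hlt k hk).1 (hq k hk))).ne'
  rw [key, Real.log_div (mul_ne_zero two_ne_zero (Finset.prod_ne_zero_iff.2 hf)) (by positivity),
    Real.log_mul two_ne_zero (Finset.prod_ne_zero_iff.2 hf), Real.log_prod hf, Real.log_pow,
    Finset.sum_congr rfl (fun k hk => by
      rw [Real.log_mul two_ne_zero (mul_pos (hlt k hk).1 (hq k hk)).ne',
        Real.log_mul (hlt k hk).1.ne' (hq k hk).ne']),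
    Finset.sum_add_distrib, Finset.sum_add_distrib, Finset.sum_const, Finset.card_range, nsmul_eq_mul]
  push_cast
  ring
end

section
/- For every real number q > 0, ∫₀¹ log(u² + q)/(1 + u) du = log 2 · log(1 + q) − arctan²(1/√q) + (1/2)·Li₂(1/(q+1)). -/
open Real MeasureTheory intervalIntegral Finset

/-- Dilogarithm Li₂(z) = Σ_{k≥1} z^k/k². -/
noncomputable def Li2 (x : ℝ) : ℝ := ∑' k : ℕ, x ^ (k + 1) / ((k : ℝ) + 1) ^ 2

open Filter Topology

lemma Li2_deriv (x : ℝ) (hx : |x| < 1) :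
    HasDerivAt Li2 (∑' k : ℕ, x ^ k / ((k : ℝ) + 1)) x := by
  obtain ⟨r, hr1, hr2⟩ := exists_between hx
  have hr0 : 0 < r := lt_of_le_of_lt (abs_nonneg x) hr1
  unfold Li2
  refine hasDerivAt_tsum_of_isPreconnected (u := fun n : ℕ => r ^ n) (t := Metric.ball (0:ℝ) r)
    (g := fun (k : ℕ) (x : ℝ) => x ^ (k + 1) / ((k : ℝ) + 1) ^ 2)
    (g' := fun (k : ℕ) (x : ℝ) => x ^ k / ((k : ℝ) + 1)) (y₀ := 0)
    (summable_geometric_of_lt_one hr0.le hr2) Metric.isOpen_ball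
    (convex_ball _ _).isPreconnected ?_ ?_ (by simpa using hr0) ?_ (by simpa using hr1)
  · intro n y _
    have h := (hasDerivAt_pow (n + 1) y).div_const (((n : ℝ) + 1) ^ 2)
    have hn : (n : ℝ) + 1 ≠ 0 := by positivity
    refine h.congr_deriv ?_
    rw [Nat.add_sub_cancel]
    push_cast
    field_simp
  · intro n y hy
    have hy' : |y| < r := by simpa using hy
    have hn : (1 : ℝ) ≤ (n : ℝ) + 1 := by linarith [(Nat.cast_nonneg n : (0:ℝ) ≤ n)]
    rw [norm_div, norm_pow, Real.norm_eq_abs, Real.norm_eq_abs, abs_of_pos (by linarith : (0:ℝ) < n + 1)]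
    calc |y| ^ n / ((n : ℝ) + 1) ≤ |y| ^ n := div_le_self (by positivity) hn
      _ ≤ r ^ n := by gcongr
  · simp

lemma Li2_deriv' (x : ℝ) (h0 : 0 < x) (h1 : x < 1) :
    HasDerivAt Li2 (-Real.log (1 - x) / x) x := by
  have hx : |x| < 1 := by rw [abs_of_pos h0]; exact h1
  refine (Li2_deriv x hx).congr_deriv ?_
  have h := (hasSum_pow_div_log_of_abs_lt_one hx).div_const x
  rw [← h.tsum_eq]
  congr 1
  ext n
  field_simp
  ring

lemma int_F' (q : ℝ) (hq : 0 < q) :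
    ∫ u in (0:ℝ)..1, (1 / (u ^ 2 + q)) / (1 + u) =
      1 / (1 + q) * (Real.log 2 + Real.arctan (1 / Real.sqrt q) / Real.sqrt q
        - (1 / 2) * (Real.log (1 + q) - Real.log q)) := by
  have hs : 0 < Real.sqrt q := Real.sqrt_pos.mpr hq
  have hsq : Real.sqrt q ^ 2 = q := Real.sq_sqrt hq.le
  rw [intervalIntegral.integral_eq_sub_of_hasDerivAt
    (f := fun u => 1 / (1 + q) * (Real.log (1 + u) + Real.arctan (u / Real.sqrt q) / Real.sqrt q
        - (1 / 2) * Real.log (u ^ 2 + q)))]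
  · norm_num
    ring
  · intro u hu
    rw [Set.uIcc_of_le zero_le_one] at hu
    have h1 : (0:ℝ) < 1 + u := by linarith [hu.1]
    have h2 : 0 < u ^ 2 + q := by positivity
    have d1 : HasDerivAt (fun u : ℝ => Real.log (1 + u)) (1 / (1 + u)) u :=
      ((hasDerivAt_id u).const_add 1).log h1.ne'
    have d2 : HasDerivAt (fun u : ℝ => Real.log (u ^ 2 + q)) (2 * u / (u ^ 2 + q)) u := by
      have := (((hasDerivAt_pow 2 u).add_const q)).log h2.ne'
      simpa using this
    have d3 : HasDerivAt (fun u : ℝ => Real.arctan (u / Real.sqrt q))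
        (1 / (1 + (u / Real.sqrt q) ^ 2) * (1 / Real.sqrt q)) u :=
      ((hasDerivAt_id u).div_const _).arctan
    refine (((d1.add (d3.div_const (Real.sqrt q))).sub (d2.const_mul (1 / 2))).const_mul
      (1 / (1 + q))).congr_deriv ?_
    have h4 : 1 / (1 + (u / Real.sqrt q) ^ 2) * (1 / Real.sqrt q) / Real.sqrt q = 1 / (u ^ 2 + q) := by
      rw [div_pow, hsq, mul_div_assoc, div_div, ← sq, hsq]
      field_simp
      ring
    rw [h4]
    field_simp
    ring
  · apply ContinuousOn.intervalIntegrable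
    rw [Set.uIcc_of_le zero_le_one]
    intro u hu
    have h1 : (1:ℝ) + u ≠ 0 := by linarith [hu.1]
    have h2 : u ^ 2 + q ≠ 0 := by positivity
    apply ContinuousAt.continuousWithinAt
    fun_prop (disch := assumption)

lemma cont_F (q : ℝ) (hq : 0 < q) :
    ContinuousOn (fun u : ℝ => Real.log (u ^ 2 + q) / (1 + u)) (Set.Icc 0 1) := by
  intro u hu
  have h1 : (1:ℝ) + u ≠ 0 := by linarith [hu.1]
  have h2 : u ^ 2 + q ≠ 0 := by positivity
  apply ContinuousAt.continuousWithinAt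
  fun_prop (disch := assumption)

lemma deriv_F (q : ℝ) (hq : 0 < q) :
    HasDerivAt (fun q => ∫ u in (0:ℝ)..1, Real.log (u ^ 2 + q) / (1 + u))
      (∫ u in (0:ℝ)..1, (1 / (u ^ 2 + q)) / (1 + u)) q := by
  refine (intervalIntegral.hasDerivAt_integral_of_dominated_loc_of_deriv_le
    (F := fun q u => Real.log (u ^ 2 + q) / (1 + u))
    (F' := fun q u => (1 / (u ^ 2 + q)) / (1 + u)) (bound := fun _ => 2 / q)
    (s := Set.Ioi (q / 2)) (Ioi_mem_nhds (by linarith)) ?_ ?_ ?_ ?_ ?_ ?_).2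
  · exact Eventually.of_forall fun x => (by fun_prop : Measurable _).aestronglyMeasurable
  · apply ContinuousOn.intervalIntegrable
    rw [Set.uIcc_of_le zero_le_one]
    exact cont_F q hq
  · exact (by fun_prop : Measurable _).aestronglyMeasurable
  · refine Eventually.of_forall fun t ht x hx => ?_
    rw [Set.uIoc_of_le zero_le_one] at ht
    have hx' : q / 2 < x := hx
    have h1 : (1:ℝ) ≤ 1 + t := by linarith [ht.1]
    have h2 : q / 2 ≤ t ^ 2 + x := by nlinarith [sq_nonneg t]
    have h3 : 0 < t ^ 2 + x := by linarith
    rw [Real.norm_of_nonneg (by positivity)]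
    calc 1 / (t ^ 2 + x) / (1 + t) ≤ 1 / (t ^ 2 + x) := div_le_self (by positivity) h1
      _ ≤ 1 / (q / 2) := by gcongr
      _ = 2 / q := by field_simp
  · simp
  · refine Eventually.of_forall fun t ht x hx => ?_
    have hx' : q / 2 < x := hx
    have h3 : 0 < t ^ 2 + x := by nlinarith [sq_nonneg t]
    exact (((hasDerivAt_id x).const_add (t ^ 2)).log h3.ne').div_const _

noncomputable def GG (q : ℝ) : ℝ :=
  (∫ u in (0:ℝ)..1, Real.log (u ^ 2 + q) / (1 + u)) -
      (Real.log 2 * Real.log (1 + q) - Real.arctan (1 / Real.sqrt q) ^ 2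
        + (1 / 2) * Li2 (1 / (q + 1)))

lemma deriv_GG (q : ℝ) (hq : 0 < q) : HasDerivAt GG 0 q := by
  have hs : 0 < Real.sqrt q := Real.sqrt_pos.mpr hq
  have hsq : Real.sqrt q ^ 2 = q := Real.sq_sqrt hq.le
  have h1 : 0 < 1 + q := by linarith
  have dF := deriv_F q hq
  rw [int_F' q hq] at dF
  have d1 : HasDerivAt (fun q : ℝ => Real.log (1 + q)) (1 / (1 + q)) q :=
    ((hasDerivAt_id q).const_add 1).log h1.ne'
  have d2 : HasDerivAt (fun q : ℝ => 1 / Real.sqrt q) (-(1 / (2 * Real.sqrt q)) / Real.sqrt q ^ 2) q := by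
    simp only [one_div (Real.sqrt _)]
    exact (Real.hasDerivAt_sqrt hq.ne').inv hs.ne'
  have d3 := d2.arctan.pow 2
  have d4 : HasDerivAt (fun q : ℝ => 1 / (q + 1)) (-1 / (q + 1) ^ 2) q := by
    simp only [one_div]
    exact ((hasDerivAt_id q).add_const 1).inv (by simp; linarith)
  have d5 := HasDerivAt.comp q (Li2_deriv' (1 / (q + 1)) (by positivity)
    (by rw [div_lt_one (by linarith)]; linarith)) d4
  have hl : Real.log (1 - 1 / (q + 1)) = Real.log q - Real.log (1 + q) := by
    rw [← Real.log_div hq.ne' h1.ne']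
    congr 1
    field_simp
    ring
  rw [hl] at d5
  refine HasDerivAt.congr_deriv (f := GG)
    (dF.sub (((d1.const_mul (Real.log 2)).sub d3).add (d5.const_mul (1 / 2)))) ?_
  have h6 : 1 / (1 + (1 / Real.sqrt q) ^ 2) * (-(1 / (2 * Real.sqrt q)) / Real.sqrt q ^ 2)
    = - 1 / (2 * Real.sqrt q * (1 + q)) := by
    rw [div_pow, hsq]
    field_simp
    ring
  rw [h6]
  generalize Real.arctan (1 / Real.sqrt q) = A
  generalize Real.log q = B
  generalize Real.log (1 + q) = C
  generalize Real.log 2 = D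
  push_cast
  field_simp
  ring

lemma int_inv : ∫ u in (0:ℝ)..1, 1 / (1 + u) = Real.log 2 := by
  rw [intervalIntegral.integral_eq_sub_of_hasDerivAt (f := fun u => Real.log (1 + u))]
  · norm_num
  · intro u hu
    rw [Set.uIcc_of_le zero_le_one] at hu
    have h1 : (0:ℝ) < 1 + u := by linarith [hu.1]
    exact ((hasDerivAt_id u).const_add 1).log h1.ne'
  · apply ContinuousOn.intervalIntegrable
    rw [Set.uIcc_of_le zero_le_one]
    intro u hu
    have h1 : (1:ℝ) + u ≠ 0 := by linarith [hu.1]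
    apply ContinuousAt.continuousWithinAt
    fun_prop (disch := assumption)

lemma F_bound (q : ℝ) (hq : 0 < q) :
    |(∫ u in (0:ℝ)..1, Real.log (u ^ 2 + q) / (1 + u)) - Real.log 2 * Real.log (1 + q)|
      ≤ 1 / q := by
  have hi : IntervalIntegrable (fun u : ℝ => 1 / (1 + u)) volume 0 1 := by
    apply ContinuousOn.intervalIntegrable
    rw [Set.uIcc_of_le zero_le_one]
    intro u hu
    have h1 : (1:ℝ) + u ≠ 0 := by linarith [hu.1]
    apply ContinuousAt.continuousWithinAt
    fun_prop (disch := assumption)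
  rw [← int_inv, ← intervalIntegral.integral_mul_const, ← intervalIntegral.integral_sub]
  · have := intervalIntegral.norm_integral_le_of_norm_le_const (a := (0:ℝ)) (b := 1) (C := 1 / q)
      (f := fun u : ℝ => Real.log (u ^ 2 + q) / (1 + u) - 1 / (1 + u) * Real.log (1 + q)) ?_
    · simpa using this
    · intro u hu
      rw [Set.uIoc_of_le zero_le_one] at hu
      have h1 : (1:ℝ) ≤ 1 + u := by linarith [hu.1]
      have h2 : 0 < u ^ 2 + q := by positivity
      have h3 : Real.log (u ^ 2 + q) ≤ Real.log (1 + q) :=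
        Real.log_le_log h2 (by nlinarith [hu.1, hu.2])
      have h4 : Real.log q ≤ Real.log (u ^ 2 + q) :=
        Real.log_le_log hq (by nlinarith [hu.1, hu.2])
      have h5 : Real.log (1 + q) - Real.log q ≤ 1 / q := by
        rw [← Real.log_div (by linarith) hq.ne']
        refine (Real.log_le_sub_one_of_pos (by positivity)).trans (le_of_eq ?_)
        field_simp
        ring
      have h6 : Real.log (u ^ 2 + q) / (1 + u) - 1 / (1 + u) * Real.log (1 + q)
        = - ((Real.log (1 + q) - Real.log (u ^ 2 + q)) / (1 + u)) := by ring
      rw [h6, norm_neg, Real.norm_of_nonneg (div_nonneg (by linarith) (by linarith))]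
      exact (div_le_self (by linarith) h1).trans (by linarith)
  · apply ContinuousOn.intervalIntegrable
    rw [Set.uIcc_of_le zero_le_one]
    exact cont_F q hq
  · exact hi.mul_const _

lemma GG_lim : Tendsto GG atTop (𝓝 0) := by
  have t1 : Tendsto (fun q : ℝ => (∫ u in (0:ℝ)..1, Real.log (u ^ 2 + q) / (1 + u))
      - Real.log 2 * Real.log (1 + q)) atTop (𝓝 0) := by
    apply squeeze_zero_norm' (a := fun q : ℝ => 1 / q)
    · filter_upwards [eventually_gt_atTop 0] with q hq
      exact F_bound q hq
    · simpa [one_div] using tendsto_inv_atTop_zero (𝕜 := ℝ)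
  have t2 : Tendsto (fun q : ℝ => Real.arctan (1 / Real.sqrt q)) atTop (𝓝 0) := by
    have h : Tendsto (fun q : ℝ => 1 / Real.sqrt q) atTop (𝓝 0) := by
      simpa [one_div, Function.comp_def] using
        (tendsto_inv_atTop_zero (𝕜 := ℝ)).comp Real.tendsto_sqrt_atTop
    have := (Real.continuous_arctan.tendsto 0).comp h
    simpa [Function.comp_def] using this
  have t3 : Tendsto (fun q : ℝ => Li2 (1 / (q + 1))) atTop (𝓝 0) := by
    have h : Tendsto (fun q : ℝ => 1 / (q + 1)) atTop (𝓝 0) := by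
      simpa [one_div, Function.comp_def] using
        (tendsto_inv_atTop_zero (𝕜 := ℝ)).comp (tendsto_atTop_add_const_right _ (1:ℝ) tendsto_id)
    have h0 : Li2 0 = 0 := by simp [Li2]
    have := ((Li2_deriv 0 (by simp)).continuousAt.tendsto).comp h
    rw [h0] at this
    exact this
  have := (t1.add (t2.pow 2)).sub (t3.const_mul (1 / 2))
  norm_num at this
  refine this.congr fun q => ?_
  unfold GG
  norm_num
  ring

theorem stmt_1 (q : ℝ) (hq : 0 < q) :
    ∫ u in (0:ℝ)..1, Real.log (u ^ 2 + q) / (1 + u) =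
      Real.log 2 * Real.log (1 + q) - Real.arctan (1 / Real.sqrt q) ^ 2
        + (1 / 2) * Li2 (1 / (q + 1)) := by
  have hc : ∀ x ∈ Set.Ioi (0:ℝ), GG x = GG q := fun x hx =>
    isOpen_Ioi.is_const_of_deriv_eq_zero (convex_Ioi 0).isPreconnected
      (fun y hy => (deriv_GG y hy).differentiableAt.differentiableWithinAt)
      (fun y hy => (deriv_GG y hy).deriv) hx hq
  have h1 : Tendsto GG atTop (𝓝 (GG q)) := by
    apply tendsto_const_nhds.congr'
    filter_upwards [eventually_gt_atTop 0] with x hx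
    exact (hc x hx).symm
  have h2 := tendsto_nhds_unique h1 GG_lim
  unfold GG at h2
  linarith
end

section
/- Let φ : ℝ → ℝ be continuously differentiable, let α, β be real numbers, and let x > 0. Then α·∫₀¹ φ′(α t)·φ(β t^x) dt + β·∫₀¹ φ′(β t)·φ(α t^(1/x)) dt = φ(α)·φ(β) − φ(0)². -/
open Real MeasureTheory intervalIntegral Finset

theorem stmt_6 (φ : ℝ → ℝ) (hφ : ContDiff ℝ 1 φ) (α β : ℝ) (x : ℝ) (hx : 0 < x) :
    α * (∫ t in (0:ℝ)..1, deriv φ (α * t) * φ (β * t ^ x))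
      + β * (∫ t in (0:ℝ)..1, deriv φ (β * t) * φ (α * t ^ (1 / x)))
      = φ α * φ β - φ 0 ^ 2 := by
  have hc : Continuous φ := hφ.continuous
  have hd : Continuous (deriv φ) := hφ.continuous_deriv le_rfl
  have hD : ∀ y, HasDerivAt φ (deriv φ y) y := fun y =>
    (hφ.differentiable one_ne_zero y).hasDerivAt
  have hp : Continuous (fun t : ℝ => t ^ x) := Real.continuous_rpow_const hx.le
  have hq : Continuous (fun t : ℝ => t ^ (1 / x)) :=
    Real.continuous_rpow_const (by positivity)
  have hr : IntervalIntegrable (fun t : ℝ => x * t ^ (x - 1)) volume 0 1 :=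
    (intervalIntegrable_rpow' (by linarith)).const_mul x
  have hf' : ∀ t ∈ Set.Ioo (min (0:ℝ) 1) (max 0 1),
      HasDerivAt (fun t : ℝ => t ^ x) (x * t ^ (x - 1)) t := by
    intro t ht
    simp only [zero_le_one, min_eq_left, max_eq_right, Set.mem_Ioo] at ht
    exact Real.hasDerivAt_rpow_const (Or.inl ht.1.ne')
  have hu1 : Continuous (fun t => deriv φ (α * t) * α) := by fun_prop
  have hw : Continuous (fun t : ℝ => deriv φ (β * t ^ x) * β) := by fun_prop
  have hv' : IntervalIntegrable (fun t : ℝ => deriv φ (β * t ^ x) * β * (x * t ^ (x - 1)))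
      volume 0 1 := hr.continuousOn_mul hw.continuousOn
  have hu : Continuous (fun t => φ (α * t)) := by fun_prop
  have hv : Continuous (fun t : ℝ => φ (β * t ^ x)) := by fun_prop
  have key := integral_deriv_mul_eq_sub_of_hasDeriv_right (a := 0) (b := 1)
    (u := fun t => φ (α * t)) (v := fun t : ℝ => φ (β * t ^ x))
    (u' := fun t => deriv φ (α * t) * α)
    (v' := fun t : ℝ => deriv φ (β * t ^ x) * β * (x * t ^ (x - 1)))
    hu.continuousOn hv.continuousOn
    (fun t _ => by
      have := (hD (α * t)).comp t ((hasDerivAt_id t).const_mul α)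
      simp only [mul_one] at this
      exact this.hasDerivWithinAt)
    (fun t ht => by
      have := (hD (β * t ^ x)).comp t ((hf' t ht).const_mul β)
      rw [← mul_assoc] at this
      exact this.hasDerivWithinAt)
    (hu1.intervalIntegrable _ _) hv'
  have hg : Continuous (fun s : ℝ => deriv φ (β * s) * φ (α * s ^ (1 / x))) := by fun_prop
  have hgf : Continuous (fun t : ℝ => deriv φ (β * t ^ x) * φ (α * (t ^ x) ^ (1 / x))) :=
    hg.comp hp
  have sub := integral_comp_mul_deriv''' (a := 0) (b := 1) (f := fun t : ℝ => t ^ x)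
    (f' := fun t : ℝ => x * t ^ (x - 1))
    (g := fun s : ℝ => deriv φ (β * s) * φ (α * s ^ (1 / x)))
    hp.continuousOn (fun t ht => (hf' t ht).hasDerivWithinAt) hg.continuousOn
    ((hg.continuousOn).integrableOn_compact (isCompact_uIcc.image hp))
    (by
      rw [Set.uIcc_of_le zero_le_one,
        ← intervalIntegrable_iff_integrableOn_Icc_of_le zero_le_one]
      exact hr.continuousOn_mul hgf.continuousOn)
  simp only [Real.zero_rpow hx.ne', Real.one_rpow] at sub
  have huv : Continuous (fun t : ℝ => deriv φ (α * t) * α * φ (β * t ^ x)) := hu1.mul hv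
  rw [intervalIntegral.integral_add (huv.intervalIntegrable _ _)
    (hv'.continuousOn_mul hu.continuousOn)] at key
  rw [← sub, ← intervalIntegral.integral_const_mul, ← intervalIntegral.integral_const_mul]
  simp only [Real.zero_rpow hx.ne', Real.one_rpow, mul_one, mul_zero] at key
  rw [sq, ← key]
  congr 1
  · exact intervalIntegral.integral_congr fun t _ => by ring
  · refine intervalIntegral.integral_congr fun t ht => ?_
    rw [Set.uIcc_of_le zero_le_one] at ht
    have : (t ^ x) ^ (1 / x) = t := by
      rw [← Real.rpow_mul ht.1, mul_one_div_cancel hx.ne', Real.rpow_one]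
    simp only [Function.comp, this]
    ring
end

section
/- Let u, v be nonzero real numbers with u < 1 and v < 1, and let x > 0. Then ∫₀¹ log(1 − u t^x)/(v^{-1} − t) dt + ∫₀¹ log(1 − v t^(1/x))/(u^{-1} − t) dt = −log(1 − u)·log(1 − v). -/
open Real MeasureTheory intervalIntegral Finset

theorem aux_pos (u s : ℝ) (hu : u < 1) (h0 : 0 ≤ s) (h1 : s ≤ 1) : 0 < 1 - u * s := by
  rcases le_or_gt u 0 with h | h
  · nlinarith
  · nlinarith

theorem aux_div (w s : ℝ) (hw : w ≠ 0) (hw1 : w < 1) (h0 : 0 ≤ s) (h1 : s ≤ 1) (a : ℝ) :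
    a / (w⁻¹ - s) = a * (w / (1 - w * s)) := by
  have := aux_pos w s hw1 h0 h1
  have e : w⁻¹ - s = (1 - w * s) / w := by field_simp
  rw [e]
  field_simp

theorem stmt_7 (u v : ℝ) (hu0 : u ≠ 0) (hv0 : v ≠ 0) (hu1 : u < 1) (hv1 : v < 1)
    (x : ℝ) (hx : 0 < x) :
    (∫ t in (0:ℝ)..1, Real.log (1 - u * t ^ x) / (v⁻¹ - t))
      + (∫ t in (0:ℝ)..1, Real.log (1 - v * t ^ (1 / x)) / (u⁻¹ - t))
      = -(Real.log (1 - u) * Real.log (1 - v)) := by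
  have hI : Set.uIcc (0:ℝ) 1 = Set.Icc 0 1 := Set.uIcc_of_le zero_le_one
  have hx' : 0 < 1 / x := by positivity
  have pw : ∀ y : ℝ, 0 < y → ∀ t ∈ Set.Icc (0:ℝ) 1, 0 ≤ t ^ y ∧ t ^ y ≤ 1 := fun y hy t ht =>
    ⟨Real.rpow_nonneg ht.1 _, Real.rpow_le_one ht.1 ht.2 hy.le⟩
  have pu : ∀ w : ℝ, w < 1 → ∀ y : ℝ, 0 < y → ∀ t ∈ Set.Icc (0:ℝ) 1, 0 < 1 - w * t ^ y :=
    fun w hw y hy t ht => aux_pos w _ hw (pw y hy t ht).1 (pw y hy t ht).2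
  have p1 : ∀ w : ℝ, w < 1 → ∀ t ∈ Set.Icc (0:ℝ) 1, 0 < 1 - w * t :=
    fun w hw t ht => aux_pos w _ hw ht.1 ht.2
  have cp : ∀ y : ℝ, 0 < y → Continuous (fun t : ℝ => t ^ y) := fun y hy =>
    Real.continuous_rpow_const hy.le
  have cl : ∀ w : ℝ, w < 1 → ∀ y : ℝ, 0 < y →
      ContinuousOn (fun t : ℝ => Real.log (1 - w * t ^ y)) (Set.Icc 0 1) := fun w hw y hy =>
    ContinuousOn.log (by have := cp y hy; fun_prop) (fun t ht => (pu w hw y hy t ht).ne')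
  have cl1 : ∀ w : ℝ, w < 1 →
      ContinuousOn (fun t : ℝ => Real.log (1 - w * t)) (Set.Icc 0 1) := fun w hw =>
    ContinuousOn.log (by fun_prop) (fun t ht => (p1 w hw t ht).ne')
  have cd : ∀ w : ℝ, w < 1 →
      ContinuousOn (fun t : ℝ => w / (1 - w * t)) (Set.Icc 0 1) := fun w hw =>
    ContinuousOn.div (by fun_prop) (by fun_prop) (fun t ht => (p1 w hw t ht).ne')
  have cdp : ContinuousOn (fun t : ℝ => u / (1 - u * t ^ x)) (Set.Icc 0 1) :=
    ContinuousOn.div (by fun_prop) (by have := cp x hx; fun_prop)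
      (fun t ht => (pu u hu1 x hx t ht).ne')
  have ir : IntervalIntegrable (fun t : ℝ => x * t ^ (x - 1)) volume 0 1 :=
    (intervalIntegral.intervalIntegrable_rpow' (by linarith)).const_mul x
  have e1 : (∫ t in (0:ℝ)..1, Real.log (1 - u * t ^ x) / (v⁻¹ - t))
      = ∫ t in (0:ℝ)..1, Real.log (1 - u * t ^ x) * (v / (1 - v * t)) := by
    apply intervalIntegral.integral_congr
    intro t ht
    rw [hI] at ht
    exact aux_div v t hv0 hv1 ht.1 ht.2 _
  have e2 : (∫ t in (0:ℝ)..1, Real.log (1 - v * t ^ (1 / x)) / (u⁻¹ - t))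
      = ∫ t in (0:ℝ)..1, Real.log (1 - v * t ^ (1 / x)) * (u / (1 - u * t)) := by
    apply intervalIntegral.integral_congr
    intro t ht
    rw [hI] at ht
    exact aux_div u t hu0 hu1 ht.1 ht.2 _
  have hinv : ∀ t ∈ Set.Icc (0:ℝ) 1, (t ^ x) ^ (1 / x) = t := fun t ht => by
    rw [← Real.rpow_mul ht.1, mul_one_div_cancel hx.ne', Real.rpow_one]
  have cg : ContinuousOn (fun t : ℝ => Real.log (1 - v * t ^ (1 / x)) * (u / (1 - u * t)))
      (Set.Icc 0 1) := (cl v hv1 _ hx').mul (cd u hu1)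
  have himg : (fun t : ℝ => t ^ x) '' (Set.Icc 0 1) ⊆ Set.Icc 0 1 := by
    rintro _ ⟨t, ht, rfl⟩
    exact pw x hx t ht
  have dr : ∀ t ∈ Set.Ioo (0:ℝ) 1, HasDerivAt (fun t : ℝ => t ^ x) (x * t ^ (x - 1)) t :=
    fun t ht => Real.hasDerivAt_rpow_const (Or.inl ht.1.ne')
  have e3 : (∫ t in (0:ℝ)..1, Real.log (1 - v * t ^ (1 / x)) * (u / (1 - u * t)))
      = ∫ t in (0:ℝ)..1, Real.log (1 - v * t) * (u / (1 - u * t ^ x)) * (x * t ^ (x - 1)) := by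
    have key := intervalIntegral.integral_comp_mul_deriv''' (a := 0) (b := 1)
      (f := fun t : ℝ => t ^ x) (f' := fun t => x * t ^ (x - 1))
      (g := fun t : ℝ => Real.log (1 - v * t ^ (1 / x)) * (u / (1 - u * t)))
      (cp x hx).continuousOn
      (fun t ht => (dr t (by simpa using ht)).hasDerivWithinAt)
      (cg.mono ((Set.image_mono (by simpa using Set.Ioo_subset_Icc_self)).trans himg))
      ((cg.integrableOn_compact isCompact_Icc).mono_set (by rw [hI]; exact himg))
      (by
        rw [← intervalIntegrable_iff']
        refine ir.continuousOn_mul ?_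
        rw [hI]
        exact cg.comp (cp x hx).continuousOn (fun t ht => pw x hx t ht))
    simp only [Real.zero_rpow hx.ne', Real.one_rpow] at key
    rw [← key]
    apply intervalIntegral.integral_congr
    intro t ht
    rw [hI] at ht
    simp only [Function.comp, hinv t ht]
  have key := intervalIntegral.integral_deriv_mul_eq_sub_of_hasDeriv_right (a := 0) (b := 1)
    (u := fun t : ℝ => Real.log (1 - u * t ^ x)) (v := fun t : ℝ => Real.log (1 - v * t))
    (u' := fun t => -((u / (1 - u * t ^ x)) * (x * t ^ (x - 1))))
    (v' := fun t => -(v / (1 - v * t)))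
    (by rw [hI]; exact cl u hu1 x hx) (by rw [hI]; exact cl1 v hv1)
    (fun t ht => by
      have ht : t ∈ Set.Ioo (0:ℝ) 1 := by simpa using ht
      have := (((dr t ht).const_mul u).const_sub 1).log
        (pu u hu1 x hx t (Set.Ioo_subset_Icc_self ht)).ne'
      refine HasDerivAt.hasDerivWithinAt (this.congr_deriv ?_)
      ring)
    (fun t ht => by
      have ht : t ∈ Set.Ioo (0:ℝ) 1 := by simpa using ht
      have := (((hasDerivAt_id t).const_mul v).const_sub 1).log
        (p1 v hv1 t (Set.Ioo_subset_Icc_self ht)).ne'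
      refine HasDerivAt.hasDerivWithinAt (this.congr_deriv ?_)
      simp only [id]
      ring)
    (ir.continuousOn_mul (by rw [hI]; exact cdp)).neg
    ((by rw [hI]; exact cd v hv1 : ContinuousOn _ (Set.uIcc (0:ℝ) 1)).intervalIntegrable).neg
  rw [e1, e2, e3, ← intervalIntegral.integral_add]
  · simp only [Real.zero_rpow hx.ne', Real.one_rpow, mul_one, mul_zero, sub_zero, Real.log_one]
      at key
    rw [← key, ← intervalIntegral.integral_neg]
    congr 1
    ext t
    ring
  · apply ContinuousOn.intervalIntegrable
    rw [hI]
    exact (cl u hu1 x hx).mul (cd v hv1)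
  · refine ir.continuousOn_mul ?_
    rw [hI]
    exact (cl1 v hv1).mul cdp
end
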